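/- arXiv:2305.20043 — 2 statements merged into one kernel-verified Lean document; each statement's English description precedes it below -/
import Mathlib

section
/- (Global Optimality of the Adversarial SCM) Let q(· | ·) be any missingness mechanism (a conditional pmf of masks given samples) such that Σ_{r ≠ 0} p_R(r) > 0 and such that for every nonzero mask r with p_R(r) > 0 the matching condition P(X_o = x_o | R = r) = p_α^r(x_o) holds for all observed parts x_o, where p_α is a strictly positive pmf on X. Then p_α is a global maximizer of the modeler's objective: J(p_α) ≥ J(θ) for every strictly positive pmf θ on X. -/
open Finset

noncomputable section

namespace AM

/-- A mask: `r i = true` means coordinate `i` is observed. -/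
abbrev Mask (d : ℕ) := Fin d → Bool

/-- The all-missing mask. -/
def zeroMask (d : ℕ) : Mask d := fun _ => false

variable {d : ℕ} {α : Fin d → Type*} [∀ i, Fintype (α i)] [∀ i, DecidableEq (α i)]
  [∀ i, Nonempty (α i)]

/-- Restriction of a sample to the observed coordinates of a mask. -/
def restr (r : Mask d) (x : ∀ i, α i) : ∀ i : {i : Fin d // r i = true}, α i.1 :=
  fun i => x i.1

/-- Observed marginal of a pmf under mask `r`. -/
def obsMarg (p : (∀ i, α i) → ℝ) (r : Mask d)
    (xo : ∀ i : {i : Fin d // r i = true}, α i.1) : ℝ :=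
  ∑ x : ∀ i, α i, if restr r x = xo then p x else 0

/-- Marginal pmf of the mask under missingness mechanism `q`. -/
def maskMarg (p : (∀ i, α i) → ℝ) (q : Mask d → (∀ i, α i) → ℝ) (r : Mask d) : ℝ :=
  ∑ x : ∀ i, α i, p x * q r x

/-- Conditional pmf of the observed part given the mask: `P(X_o = x_o | R = r)`. -/
def condObs (p : (∀ i, α i) → ℝ) (q : Mask d → (∀ i, α i) → ℝ) (r : Mask d)
    (xo : ∀ i : {i : Fin d // r i = true}, α i.1) : ℝ :=
  (∑ x : ∀ i, α i, if restr r x = xo then p x * q r x else 0) / maskMarg p q r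

/-- The number of missing coordinates of a mask. -/
def missCount {d : ℕ} (r : Mask d) : ℕ := (univ.filter fun i => r i = false).card

/-- Total mass of the nonzero masks. -/
def totMass (p : (∀ i, α i) → ℝ) (q : Mask d → (∀ i, α i) → ℝ) : ℝ :=
  ∑ r' ∈ univ.filter (fun r' : Mask d => r' ≠ zeroMask d), maskMarg p q r'

/-- The modeler's objective. -/
def Jobj (p : (∀ i, α i) → ℝ) (q : Mask d → (∀ i, α i) → ℝ) (θ : (∀ i, α i) → ℝ) : ℝ :=
  ∑ r : Mask d,
    if r ≠ zeroMask d ∧ 0 < maskMarg p q r then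
      maskMarg p q r / totMass p q *
        ∑ xo : ∀ i : {i : Fin d // r i = true}, α i.1,
          condObs p q r xo * Real.log (obsMarg θ r xo)
    else 0

/-- Likelihood ratio of adversarial to true observed marginals. -/
def Lam (p pα : (∀ i, α i) → ℝ) (r : Mask d)
    (xo : ∀ i : {i : Fin d // r i = true}, α i.1) : ℝ :=
  obsMarg pα r xo / obsMarg p r xo

/-- Maximum of the likelihood ratio over observed parts. -/
def LamMax (p pα : (∀ i, α i) → ℝ) (r : Mask d) : ℝ :=
  Finset.univ.sup' Finset.univ_nonempty (Lam p pα r)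

/-- Generalized rejection sampling missingness mechanism with weights `w`. -/
def grs (p pα : (∀ i, α i) → ℝ) (w : Mask d → ℝ) (r : Mask d) (x : ∀ i, α i) : ℝ :=
  if r = zeroMask d then
    1 - ∑ r' ∈ univ.filter (fun r' : Mask d => r' ≠ zeroMask d),
          w r' * Lam p pα r' (restr r' x) / LamMax p pα r'
  else w r * Lam p pα r (restr r x) / LamMax p pα r

/-- Restriction of a sample to the coordinates in a finset. -/
def restrS (S : Finset (Fin d)) (x : ∀ i, α i) : ∀ i : {i : Fin d // i ∈ S}, α i.1 :=
  fun i => x i.1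

/-- Marginal pmf of the coordinates in `S`. -/
def margS (p : (∀ i, α i) → ℝ) (S : Finset (Fin d))
    (xs : ∀ i : {i : Fin d // i ∈ S}, α i.1) : ℝ :=
  ∑ x : ∀ i, α i, if restrS S x = xs then p x else 0

/-- Ratio of adversarial to true marginals on `V`. -/
def LamV (p pα : (∀ i, α i) → ℝ) (V : Finset (Fin d))
    (xv : ∀ i : {i : Fin d // i ∈ V}, α i.1) : ℝ :=
  margS pα V xv / margS p V xv

/-- Maximum of the ratio over configurations of `V`. -/
def LamVMax (p pα : (∀ i, α i) → ℝ) (V : Finset (Fin d)) : ℝ :=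
  Finset.univ.sup' Finset.univ_nonempty (LamV p pα V)

/-- Localized rejection sampling missingness mechanism on `V`. -/
def lrs (p pα : (∀ i, α i) → ℝ) (V : Finset (Fin d)) (r : Mask d) (x : ∀ i, α i) : ℝ :=
  if ∀ i ∉ V, r i = true then
    if ∃ i ∈ V, r i = true then
      1 / ((2 : ℝ) ^ V.card - 1) * (LamV p pα V (restrS V x) / LamVMax p pα V)
    else 1 - LamV p pα V (restrS V x) / LamVMax p pα V
  else 0

/-- Conditional pmf of the complement coordinates given the `V` coordinates. -/
def condComp (p : (∀ i, α i) → ℝ) (V : Finset (Fin d))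
    (xv : ∀ i : {i : Fin d // i ∈ V}, α i.1)
    (xc : ∀ i : {i : Fin d // i ∈ Vᶜ}, α i.1) : ℝ :=
  (∑ x : ∀ i, α i, if restrS V x = xv ∧ restrS Vᶜ x = xc then p x else 0) / margS p V xv

/-- Conditional pmf of the `V` coordinates given the mask: `P(X_V = x_V | R = r)`. -/
def condV (p : (∀ i, α i) → ℝ) (q : Mask d → (∀ i, α i) → ℝ) (V : Finset (Fin d)) (r : Mask d)
    (xv : ∀ i : {i : Fin d // i ∈ V}, α i.1) : ℝ :=
  (∑ x : ∀ i, α i, if restrS V x = xv then p x * q r x else 0) / maskMarg p q r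

/-- Conditional pmf of coordinate `j` given that the coordinates in `S` equal `z`. -/
def condAt (p : (∀ i, α i) → ℝ) (S : Finset (Fin d)) (j : Fin d)
    (z : ∀ i : {i : Fin d // i ∈ S}, α i.1) (a : α j) : ℝ :=
  (∑ x : ∀ i, α i, if restrS S x = z ∧ x j = a then p x else 0) / margS p S z

/-- `p` factorizes according to the parent structure `pa`. -/
def Factorizes (p : (∀ i, α i) → ℝ) (pa : Fin d → Finset (Fin d)) : Prop :=
  ∀ x, p x = ∏ j, condAt p (pa j) j (restrS (pa j) x) (x j)

/-- KL divergence between two pmfs on a finite type. -/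
def KL {β : Type*} [Fintype β] (p q : β → ℝ) : ℝ :=
  ∑ b, p b * Real.log (p b / q b)


/-- The Gibbs inequality: cross entropy is minimized by the true distribution. -/
theorem sum_mul_log_le_sum_mul_log {β : Type*} [Fintype β] {f g : β → ℝ}
    (hf : ∀ b, 0 < f b) (hg : ∀ b, 0 < g b) (hfg : ∑ b, g b ≤ ∑ b, f b) :
    ∑ b, f b * Real.log (g b) ≤ ∑ b, f b * Real.log (f b) := by
  have hterm : ∀ b, f b * Real.log (g b) ≤ f b * Real.log (f b) + (g b - f b) := by
    intro b
    have hlog := Real.log_le_sub_one_of_pos (div_pos (hg b) (hf b))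
    rw [Real.log_div (hg b).ne' (hf b).ne'] at hlog
    have hmul := mul_le_mul_of_nonneg_left hlog (hf b).le
    rw [mul_sub, mul_sub, mul_div_cancel₀ _ (hf b).ne', mul_one] at hmul
    linarith
  have hsum := Finset.sum_le_sum fun b (_ : b ∈ univ) => hterm b
  rw [Finset.sum_add_distrib, Finset.sum_sub_distrib] at hsum
  linarith

theorem sum_obsMarg {d : ℕ} {α : Fin d → Type*} [∀ i, Fintype (α i)]
    [∀ i, DecidableEq (α i)] (p : (∀ i, α i) → ℝ) (r : Mask d) :
    ∑ xo, obsMarg p r xo = ∑ x, p x := by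
  unfold obsMarg
  rw [Finset.sum_comm]
  simp

/-- Every observed part extends to a full sample. -/
theorem restr_surjective {d : ℕ} {α : Fin d → Type*} [∀ i, Nonempty (α i)] (r : Mask d) :
    Function.Surjective (restr (α := α) r) := by
  intro xo
  refine ⟨fun i => if h : r i = true then xo ⟨i, h⟩ else Classical.arbitrary _, ?_⟩
  funext i
  simp [restr, i.2]

theorem obsMarg_pos {p : (∀ i, α i) → ℝ} (hp : ∀ x, 0 < p x) (r : Mask d)
    (xo : ∀ i : {i : Fin d // r i = true}, α i.1) : 0 < obsMarg p r xo := by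
  obtain ⟨x, hx⟩ := restr_surjective r xo
  refine Finset.sum_pos' (fun y _ => ?_) ⟨x, mem_univ x, ?_⟩
  · split_ifs
    exacts [(hp y).le, le_rfl]
  · simpa [hx] using hp x

/-- Global Optimality of the Adversarial SCM: if the missingness mechanism
satisfies the matching condition, then `p_α` globally maximizes the modeler's objective. -/
theorem stmt2
    {d : ℕ} (hd : 1 ≤ d) {α : Fin d → Type*} [∀ i, Fintype (α i)] [∀ i, DecidableEq (α i)]
    [∀ i, Nonempty (α i)]
    (p : (∀ i, α i) → ℝ) (hp_pos : ∀ x, 0 < p x) (hp_sum : ∑ x, p x = 1)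
    (q : Mask d → (∀ i, α i) → ℝ)
    (hq_nonneg : ∀ r x, 0 ≤ q r x) (hq_sum : ∀ x, ∑ r : Mask d, q r x = 1)
    (hpos : 0 < totMass p q)
    (pα : (∀ i, α i) → ℝ) (hpα_pos : ∀ x, 0 < pα x) (hpα_sum : ∑ x, pα x = 1)
    (hmatch : ∀ r : Mask d, r ≠ zeroMask d → 0 < maskMarg p q r →
      ∀ xo : ∀ i : {i : Fin d // r i = true}, α i.1,
        condObs p q r xo = obsMarg pα r xo)
    (θ : (∀ i, α i) → ℝ) (hθ_pos : ∀ x, 0 < θ x) (hθ_sum : ∑ x, θ x = 1) :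
    Jobj p q θ ≤ Jobj p q pα := by
  refine Finset.sum_le_sum fun r _ => ?_
  split_ifs with h
  · refine mul_le_mul_of_nonneg_left ?_ (div_nonneg h.2.le hpos.le)
    simp only [hmatch r h.1 h.2]
    refine sum_mul_log_le_sum_mul_log (obsMarg_pos hpα_pos r) (obsMarg_pos hθ_pos r) ?_
    rw [sum_obsMarg, sum_obsMarg, hθ_sum, hpα_sum]
  · exact le_rfl

end AM
end
end

section
/- Under the localized rejection sampling missingness mechanism on V, the expected missingness rate is bounded: Σ_r p_R(r)·ℓ_r/d ≤ (1 − 1/(2Λ))·|V|/d. -/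
open Finset

noncomputable section

namespace AM

variable {d : ℕ} {α : Fin d → Type*} [∀ i, Fintype (α i)] [∀ i, DecidableEq (α i)]
  [∀ i, Nonempty (α i)]

/-- The mask whose missing coordinates are exactly those in `S`. -/
def missingOn {d : ℕ} (S : Finset (Fin d)) : Mask d := fun i => decide (i ∉ S)

theorem missCount_missingOn {d : ℕ} (S : Finset (Fin d)) : missCount (missingOn S) = S.card := by
  simp [missCount, missingOn]

theorem missingOn_filter_false {d : ℕ} (r : Mask d) :
    missingOn (univ.filter fun i => r i = false) = r := by
  funext i
  cases h : r i <;> simp [missingOn, h]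

theorem sum_mask_eq_sum_finset {d : ℕ} (f : Mask d → ℝ) :
    ∑ r, f r = ∑ S : Finset (Fin d), f (missingOn S) := by
  refine Finset.sum_nbij' (fun r => univ.filter fun i => r i = false) missingOn
    (by simp) (by simp) (fun r _ => missingOn_filter_false r) ?_ ?_
  · intro S _
    ext i
    simp [missingOn]
  · intro r _
    rw [missingOn_filter_false]

theorem two_mul_sum_powerset_card {ι : Type*} [DecidableEq ι] (V : Finset ι) :
    2 * ∑ S ∈ V.powerset, (S.card : ℝ) = V.card * 2 ^ V.card := by
  have hflip : ∑ S ∈ V.powerset, (S.card : ℝ) = ∑ S ∈ V.powerset, ((V \ S).card : ℝ) := by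
    refine Finset.sum_nbij' (fun S => V \ S) (fun S => V \ S) ?_ ?_ ?_ ?_ ?_
    · simp
    · simp
    · intro S hS
      exact Finset.sdiff_sdiff_eq_self (Finset.mem_powerset.1 hS)
    · intro S hS
      exact Finset.sdiff_sdiff_eq_self (Finset.mem_powerset.1 hS)
    · intro S hS
      simp [Finset.inter_eq_right.2 (Finset.mem_powerset.1 hS)]
  have hadd : ∀ S ∈ V.powerset, (S.card : ℝ) + ((V \ S).card : ℝ) = V.card := by
    intro S hS
    have h := Finset.card_sdiff_add_card_eq_card (Finset.mem_powerset.1 hS)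
    rw [← h]
    push_cast
    ring
  rw [two_mul]
  nth_rewrite 2 [hflip]
  rw [← Finset.sum_add_distrib, Finset.sum_congr rfl hadd]
  simp [mul_comm]

theorem margS_nonneg {d : ℕ} {α : Fin d → Type*} [∀ i, Fintype (α i)]
    [∀ i, DecidableEq (α i)] {p : (∀ i, α i) → ℝ} (hp : ∀ x, 0 ≤ p x) (S : Finset (Fin d))
    (xs : ∀ i : {i : Fin d // i ∈ S}, α i.1) : 0 ≤ margS p S xs :=
  Finset.sum_nonneg fun x _ => by split_ifs <;> simp [hp x]

theorem exists_restrS_eq {d : ℕ} {α : Fin d → Type*} [∀ i, Nonempty (α i)]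
    (S : Finset (Fin d)) (xs : ∀ i : {i : Fin d // i ∈ S}, α i.1) :
    ∃ x : ∀ i, α i, restrS S x = xs := by
  refine ⟨fun i => if h : i ∈ S then xs ⟨i, h⟩ else Classical.arbitrary _, ?_⟩
  funext i
  simp [restrS]

theorem margS_pos {p : (∀ i, α i) → ℝ} (hp : ∀ x, 0 < p x) (S : Finset (Fin d))
    (xs : ∀ i : {i : Fin d // i ∈ S}, α i.1) : 0 < margS p S xs := by
  obtain ⟨x, hx⟩ := exists_restrS_eq S xs
  refine Finset.sum_pos' (fun y _ => ?_) ⟨x, Finset.mem_univ _, ?_⟩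
  · split_ifs
    · exact (hp y).le
    · exact le_rfl
  · rw [if_pos hx]
    exact hp x

theorem sum_mul_restrS {d : ℕ} {α : Fin d → Type*} [∀ i, Fintype (α i)]
    [∀ i, DecidableEq (α i)] (p : (∀ i, α i) → ℝ) (S : Finset (Fin d))
    (f : (∀ i : {i : Fin d // i ∈ S}, α i.1) → ℝ) :
    ∑ x, p x * f (restrS S x) = ∑ xs, margS p S xs * f xs := by
  simp only [margS, Finset.sum_mul]
  rw [Finset.sum_comm]
  simp

/-- The likelihood ratio has mean one under the true pmf. -/
theorem sum_mul_LamV {p pα : (∀ i, α i) → ℝ} (hp : ∀ x, 0 < p x) (V : Finset (Fin d)) :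
    ∑ x, p x * LamV p pα V (restrS V x) = ∑ x, pα x := by
  have h := sum_mul_restrS pα V fun _ => 1
  simp only [mul_one] at h
  rw [sum_mul_restrS p V (LamV p pα V), h]
  exact Finset.sum_congr rfl fun xs _ => mul_div_cancel₀ _ (margS_pos hp V xs).ne'

theorem LamV_nonneg {d : ℕ} {α : Fin d → Type*} [∀ i, Fintype (α i)]
    [∀ i, DecidableEq (α i)] {p pα : (∀ i, α i) → ℝ} (hp : ∀ x, 0 ≤ p x) (hpα : ∀ x, 0 ≤ pα x)
    (V : Finset (Fin d)) (xv : ∀ i : {i : Fin d // i ∈ V}, α i.1) : 0 ≤ LamV p pα V xv :=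
  div_nonneg (margS_nonneg hpα V xv) (margS_nonneg hp V xv)

theorem LamVMax_nonneg {p pα : (∀ i, α i) → ℝ} (hp : ∀ x, 0 ≤ p x) (hpα : ∀ x, 0 ≤ pα x)
    (V : Finset (Fin d)) : 0 ≤ LamVMax p pα V :=
  (LamV_nonneg hp hpα V (Classical.arbitrary _)).trans
    (Finset.le_sup' (LamV p pα V) (Finset.mem_univ _))

theorem lrs_missingOn (p pα : (∀ i, α i) → ℝ) (V S : Finset (Fin d)) (x : ∀ i, α i) :
    lrs p pα V (missingOn S) x =
      if S ⊆ V then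
        if S = V then 1 - LamV p pα V (restrS V x) / LamVMax p pα V
        else 1 / ((2 : ℝ) ^ V.card - 1) * (LamV p pα V (restrS V x) / LamVMax p pα V)
      else 0 := by
  have hsub : (∀ i ∉ V, missingOn S i = true) ↔ S ⊆ V := by
    simp only [missingOn, decide_eq_true_eq]
    exact forall_congr' fun i => not_imp_not
  have hobs : (∃ i ∈ V, missingOn S i = true) ↔ ¬ V ⊆ S := by
    simp [missingOn, Finset.not_subset]
  rw [lrs]
  simp only [hsub, hobs]
  by_cases h : S ⊆ V
  · have heq : V ⊆ S ↔ S = V := ⟨fun h' => h.antisymm h', fun h' => h'.ge⟩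
    simp only [heq, ite_not]
  · simp [h]

/-- Bound on the expected number of missing coordinates given the sample `x`. -/
theorem sum_lrs_mul_missCount_le {p pα : (∀ i, α i) → ℝ} (hp : ∀ x, 0 ≤ p x)
    (hpα : ∀ x, 0 ≤ pα x) {V : Finset (Fin d)} (hV : V.Nonempty) (x : ∀ i, α i) :
    ∑ r, lrs p pα V r x * (missCount r : ℝ) ≤
      (1 - LamV p pα V (restrS V x) / LamVMax p pα V / 2) * V.card := by
  have ht : 0 ≤ LamV p pα V (restrS V x) / LamVMax p pα V :=
    div_nonneg (LamV_nonneg hp hpα V _) (LamVMax_nonneg hp hpα V)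
  rw [sum_mask_eq_sum_finset]
  simp only [lrs_missingOn, missCount_missingOn]
  generalize LamV p pα V (restrS V x) / LamVMax p pα V = t at ht ⊢
  have hpow : 0 < (2 : ℝ) ^ V.card - 1 :=
    sub_pos.2 (one_lt_pow₀ one_lt_two hV.card_ne_zero)
  obtain ⟨c, hc⟩ : ∃ c : ℝ, c = 1 / ((2 : ℝ) ^ V.card - 1) := ⟨_, rfl⟩
  have hc0 : 0 ≤ c := hc ▸ (one_div_pos.2 hpow).le
  have hc1 : c * 2 ^ V.card = 1 + c := by
    rw [hc]
    field_simp
    ring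
  rw [← hc]
  have hsum : ∑ S : Finset (Fin d), (if S ⊆ V then if S = V then 1 - t else c * t else 0) *
      (S.card : ℝ) = c * t * ∑ S ∈ V.powerset, (S.card : ℝ) + (1 - t - c * t) * V.card := by
    have hsplit : ∀ S : Finset (Fin d),
        (if S ⊆ V then if S = V then 1 - t else c * t else 0) * (S.card : ℝ) =
          (if S ∈ V.powerset then c * t * (S.card : ℝ) else 0) +
            if S = V then (1 - t - c * t) * (S.card : ℝ) else 0 := by
      intro S
      by_cases h : S = V
      · subst h
        simp
        ring
      · by_cases h' : S ⊆ V <;> simp [h, h']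
    rw [Finset.sum_congr rfl fun S _ => hsplit S, Finset.sum_add_distrib, Finset.mul_sum,
      Finset.sum_ite_mem, Finset.univ_inter, Finset.sum_ite_eq', if_pos (Finset.mem_univ V)]
  have hcard := two_mul_sum_powerset_card V
  have hctk : 0 ≤ c * t * V.card := by positivity
  rw [hsum]
  linear_combination (c * t / 2) * hcard + (t * V.card / 2) * hc1 + hctk / 2

/-- under localized rejection sampling on `V`, the expected missingness rate is
bounded by `(1 − 1/(2Λ))·|V|/d`. -/
theorem stmt10
    {d : ℕ} (hd : 1 ≤ d) {α : Fin d → Type*} [∀ i, Fintype (α i)] [∀ i, DecidableEq (α i)]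
    [∀ i, Nonempty (α i)]
    (p pα : (∀ i, α i) → ℝ)
    (hp_pos : ∀ x, 0 < p x) (hp_sum : ∑ x, p x = 1)
    (hpα_nonneg : ∀ x, 0 ≤ pα x) (hpα_sum : ∑ x, pα x = 1)
    (V : Finset (Fin d)) (hV : V.Nonempty) :
    ∑ r : Mask d, maskMarg p (lrs p pα V) r * ((missCount r : ℝ) / d)
      ≤ (1 - 1 / (2 * LamVMax p pα V)) * ((V.card : ℝ) / d) := by
  have hp : ∀ x, 0 ≤ p x := fun x => (hp_pos x).le
  have hmean : ∑ x, p x * LamV p pα V (restrS V x) = 1 := (sum_mul_LamV hp_pos V).trans hpα_sum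
  calc ∑ r : Mask d, maskMarg p (lrs p pα V) r * ((missCount r : ℝ) / d)
      = ∑ x, p x * (∑ r, lrs p pα V r x * (missCount r : ℝ)) / d := by
        simp only [maskMarg, Finset.sum_mul, Finset.mul_sum, Finset.sum_div]
        rw [Finset.sum_comm]
        exact Finset.sum_congr rfl fun x _ => Finset.sum_congr rfl fun r _ => by ring
    _ ≤ ∑ x, p x * ((1 - LamV p pα V (restrS V x) / LamVMax p pα V / 2) * V.card) / d := by
        gcongr with x
        · exact hp x
        · exact sum_lrs_mul_missCount_le hp hpα_nonneg hV x
    _ = (∑ x, p x - (∑ x, p x * LamV p pα V (restrS V x)) / (2 * LamVMax p pα V)) *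
          ((V.card : ℝ) / d) := by
        rw [Finset.sum_div, ← Finset.sum_sub_distrib, Finset.sum_mul]
        refine Finset.sum_congr rfl fun x _ => ?_
        rw [div_div, mul_comm (LamVMax p pα V) 2]
        ring
    _ = (1 - 1 / (2 * LamVMax p pα V)) * ((V.card : ℝ) / d) := by rw [hp_sum, hmean]

end AM
end
end
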